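/- Let H be a real Hilbert space and let A : H →L[ℝ] H be a self-adjoint (symmetric) bounded operator with ‖A‖ ≤ 1. Then the block-diagonal operator diag(A, A) on the Hilbert space direct sum H ⊕ H (the space H × H with the ℓ² product inner product), given by (x, y) ↦ (A x, A y), is the average of two orthogonal operators: there exist orthogonal operators U and V on H ⊕ H such that diag(A, A) = (1/2 : ℝ) • (U + V). -/

import Mathlib

open Filter Topology

section Helpers
variable {H : Type*} [NormedAddCommGroup H] [InnerProductSpace ℝ H] [CompleteSpace H]

/-- Scalar comparison sequence. -/
noncomputable def avgScal : ℕ → ℝ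
  | 0 => 0
  | n + 1 => (1 / 2) * (1 + avgScal n * avgScal n)

/-- Operator iteration converging to `1 - sqrt (1 - Q)`. -/
noncomputable def avgIter (Q : H →L[ℝ] H) : ℕ → (H →L[ℝ] H)
  | 0 => 0
  | n + 1 => (1 / 2 : ℝ) • (Q + avgIter Q n * avgIter Q n)

lemma avgScal_bounds (n : ℕ) : 0 ≤ avgScal n ∧ avgScal n ≤ 1 := by
  induction n with
  | zero => simp [avgScal]
  | succ n ih =>
    obtain ⟨h0, h1⟩ := ih
    simp only [avgScal]
    constructor <;> nlinarith

lemma avgScal_mono (n : ℕ) : avgScal n ≤ avgScal (n + 1) := by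
  simp only [avgScal]
  nlinarith [sq_nonneg (avgScal n - 1)]

lemma avgIter_norm (Q : H →L[ℝ] H) (hQ : ‖Q‖ ≤ 1) (n : ℕ) : ‖avgIter Q n‖ ≤ avgScal n := by
  induction n with
  | zero => simp [avgScal, avgIter]
  | succ n ih =>
    simp only [avgScal, avgIter]
    rw [norm_smul, Real.norm_of_nonneg (by norm_num)]
    gcongr
    refine (norm_add_le _ _).trans (add_le_add hQ ((norm_mul_le _ _).trans ?_))
    gcongr
    exact (avgScal_bounds n).1

lemma avgIter_diff (Q : H →L[ℝ] H) (hQ : ‖Q‖ ≤ 1) (n : ℕ) :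
    ‖avgIter Q (n + 1) - avgIter Q n‖ ≤ avgScal (n + 1) - avgScal n := by
  induction n with
  | zero => simpa [avgScal, avgIter] using avgIter_norm Q hQ 1
  | succ n ih =>
    have e1 : avgIter Q (n + 1 + 1) - avgIter Q (n + 1) = (1 / 2 : ℝ) •
        (avgIter Q (n + 1) * (avgIter Q (n + 1) - avgIter Q n)
          + (avgIter Q (n + 1) - avgIter Q n) * avgIter Q n) := by
      rw [show avgIter Q (n + 1 + 1) =
        (1 / 2 : ℝ) • (Q + avgIter Q (n + 1) * avgIter Q (n + 1)) from rfl]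
      nth_rewrite 3 [show avgIter Q (n + 1) =
        (1 / 2 : ℝ) • (Q + avgIter Q n * avgIter Q n) from rfl]
      rw [← smul_sub]
      congr 1
      noncomm_ring
    have e2 : avgScal (n + 1 + 1) - avgScal (n + 1) = (1 / 2) *
        (avgScal (n + 1) * (avgScal (n + 1) - avgScal n)
          + (avgScal (n + 1) - avgScal n) * avgScal n) := by
      rw [show avgScal (n + 1 + 1) =
        (1 / 2) * (1 + avgScal (n + 1) * avgScal (n + 1)) from rfl]
      nth_rewrite 3 [show avgScal (n + 1) = (1 / 2) * (1 + avgScal n * avgScal n) from rfl]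
      ring
    have m := avgScal_mono n
    rw [e1, e2, norm_smul, Real.norm_of_nonneg (by norm_num)]
    gcongr
    refine (norm_add_le _ _).trans (add_le_add ((norm_mul_le _ _).trans ?_)
      ((norm_mul_le _ _).trans ?_))
    · exact mul_le_mul (avgIter_norm Q hQ _) ih (norm_nonneg _) (avgScal_bounds _).1
    · exact mul_le_mul ih (avgIter_norm Q hQ _) (norm_nonneg _) (by linarith)

lemma avg_exists_sqrt (A : H →L[ℝ] H) (hA : IsSelfAdjoint A) (hnorm : ‖A‖ ≤ 1) :
    ∃ B : H →L[ℝ] H, IsSelfAdjoint B ∧ Commute A B ∧ A * A + B * B = 1 := by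
  have hQ : ‖A * A‖ ≤ 1 := (norm_mul_le _ _).trans (by nlinarith [norm_nonneg A])
  have hc : CauchySeq (avgIter (A * A)) := by
    refine cauchySeq_of_dist_le_of_summable (fun n => avgScal (n + 1) - avgScal n) ?_ ?_
    · intro n
      rw [dist_comm, dist_eq_norm]
      exact avgIter_diff _ hQ n
    · refine summable_of_sum_range_le (c := 1) (fun n => sub_nonneg.2 (avgScal_mono n)) ?_
      intro n
      rw [Finset.sum_range_sub]
      simpa [avgScal] using (avgScal_bounds n).2
  obtain ⟨Y, hY⟩ := cauchySeq_tendsto_of_complete hc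
  have hsa : IsSelfAdjoint Y := by
    have h : ∀ n, star (avgIter (A * A) n) = avgIter (A * A) n := by
      intro n
      induction n with
      | zero => simp [avgIter]
      | succ n ih => simp [avgIter, ih, hA.star_eq]
    have h2 := (continuous_star.tendsto Y).comp hY
    exact tendsto_nhds_unique (h2.congr h) hY
  have hcomm : Commute A Y := by
    have h : ∀ n, Commute A (avgIter (A * A) n) := by
      intro n
      induction n with
      | zero => exact Commute.zero_right _
      | succ n ih =>
        exact ((((Commute.refl A).mul_right (Commute.refl A)).add_right
          (ih.mul_right ih)).smul_right _)
    exact tendsto_nhds_unique (hY.const_mul A) ((hY.mul_const A).congr fun n => (h n).eq.symm)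
  have hfix : Y = (1 / 2 : ℝ) • (A * A + Y * Y) :=
    tendsto_nhds_unique ((tendsto_add_atTop_iff_nat 1).2 hY)
      (((hY.mul hY).const_add (A * A)).const_smul (1 / 2 : ℝ))
  have h2 : Y + Y = A * A + Y * Y := by
    nth_rewrite 1 2 [hfix]
    rw [← add_smul]; norm_num
  refine ⟨1 - Y, (IsSelfAdjoint.one _).sub hsa, (Commute.one_right A).sub_right hcomm, ?_⟩
  have : A * A + (1 - Y) * (1 - Y) = 1 + (A * A + Y * Y) - (Y + Y) := by noncomm_ring
  rw [this, h2]; simp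

/-- The block operator `[[A, B], [-B, A]]`. -/
noncomputable def avgBlock (A B : H →L[ℝ] H) : WithLp 2 (H × H) →L[ℝ] WithLp 2 (H × H) :=
  (WithLp.prodContinuousLinearEquiv 2 ℝ H H).symm.toContinuousLinearMap ∘L
    ((A ∘L ContinuousLinearMap.fst ℝ H H + B ∘L ContinuousLinearMap.snd ℝ H H).prod
      (A ∘L ContinuousLinearMap.snd ℝ H H - B ∘L ContinuousLinearMap.fst ℝ H H)) ∘L
    (WithLp.prodContinuousLinearEquiv 2 ℝ H H).toContinuousLinearMap

lemma avgBlock_apply (A B : H →L[ℝ] H) (z : WithLp 2 (H × H)) :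
    avgBlock A B z = WithLp.toLp 2 (A z.fst + B z.snd, A z.snd - B z.fst) := rfl

lemma avgBlock_star (A B : H →L[ℝ] H) (hA : IsSelfAdjoint A) (hB : IsSelfAdjoint B) :
    star (avgBlock A B) = avgBlock A (-B) := by
  rw [ContinuousLinearMap.star_eq_adjoint]
  symm
  rw [ContinuousLinearMap.eq_adjoint_iff]
  intro x y
  have a : ∀ u v, inner ℝ (A u) v = inner ℝ u (A v) := hA.isSymmetric
  have b : ∀ u v, inner ℝ (B u) v = inner ℝ u (B v) := hB.isSymmetric
  simp [avgBlock_apply, WithLp.prod_inner_apply, inner_add_left, inner_add_right,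
    inner_sub_right, inner_sub_left, a, b]
  ring

lemma avgBlock_mul (A B : H →L[ℝ] H) (hc : Commute A B) (h : A * A + B * B = 1) :
    avgBlock A B * avgBlock A (-B) = 1 := by
  have c : ∀ x, A (B x) = B (A x) := fun x => DFunLike.congr_fun hc.eq x
  have s : ∀ x, A (A x) + B (B x) = x := fun x => DFunLike.congr_fun h x
  ext x
  apply (WithLp.equiv 2 (H × H)).injective
  refine Prod.ext ?_ ?_
  · change A (A x.fst + (-B) x.snd) + B (A x.snd - (-B) x.fst) = x.fst
    refine Eq.trans ?_ (s x.fst)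
    simp [c]
  · change A (A x.snd - (-B) x.fst) - B (A x.fst + (-B) x.snd) = x.snd
    refine Eq.trans ?_ (s x.snd)
    simp [c]
    abel

lemma avgBlock_unitary (A B : H →L[ℝ] H) (hA : IsSelfAdjoint A) (hB : IsSelfAdjoint B)
    (hc : Commute A B) (h : A * A + B * B = 1) :
    avgBlock A B ∈ unitary (WithLp 2 (H × H) →L[ℝ] WithLp 2 (H × H)) := by
  rw [Unitary.mem_iff, avgBlock_star A B hA hB]
  refine ⟨?_, avgBlock_mul A B hc h⟩
  simpa using avgBlock_mul A (-B) hc.neg_right (by simpa using h)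

end Helpers


/-- for a self-adjoint bounded operator `A` of norm at most 1 on a real
Hilbert space `H`, the block-diagonal operator `diag(A, A)` on the Hilbert space direct
sum `H ⊕ H` (i.e. `WithLp 2 (H × H)`) is the average of two orthogonal operators. -/
theorem blockDiag_selfAdjoint_avg_of_two_orthogonals
    {H : Type*} [NormedAddCommGroup H] [InnerProductSpace ℝ H] [CompleteSpace H]
    (A : H →L[ℝ] H) (hA : IsSelfAdjoint A) (hnorm : ‖A‖ ≤ 1) :
    ∃ U V : WithLp 2 (H × H) →L[ℝ] WithLp 2 (H × H),
      U ∈ unitary (WithLp 2 (H × H) →L[ℝ] WithLp 2 (H × H)) ∧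
      V ∈ unitary (WithLp 2 (H × H) →L[ℝ] WithLp 2 (H × H)) ∧
      ((WithLp.prodContinuousLinearEquiv 2 ℝ H H).symm.toContinuousLinearMap ∘L
          (A.prodMap A) ∘L
          (WithLp.prodContinuousLinearEquiv 2 ℝ H H).toContinuousLinearMap) =
        (1 / 2 : ℝ) • (U + V) := by
  obtain ⟨B, hB, hc, h⟩ := avg_exists_sqrt A hA hnorm
  refine ⟨avgBlock A B, avgBlock A (-B), avgBlock_unitary A B hA hB hc h,
    avgBlock_unitary A (-B) hA hB.neg hc.neg_right (by simpa using h), ?_⟩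
  ext x
  apply (WithLp.equiv 2 (H × H)).injective
  refine Prod.ext ?_ ?_
  · change A x.fst = (1 / 2 : ℝ) • ((A x.fst + B x.snd) + (A x.fst + (-B) x.snd))
    rw [ContinuousLinearMap.neg_apply]
    module
  · change A x.snd = (1 / 2 : ℝ) • ((A x.snd - B x.fst) + (A x.snd - (-B) x.fst))
    rw [ContinuousLinearMap.neg_apply]
    module
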